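/- arXiv:2511.11893 — 2 statements merged into one kernel-verified Lean document; each statement's English description precedes it below -/
import Mathlib

section
/- For every integer N ≥ 1 and every integer i, dim_K H^i(C ⊗ K[X]/(X^N), D) ≤ dim_K H^i(C, δ) + (N−1)·β_i. -/
open Polynomial

/-- Dimension of the cohomology `ker g / (im f ∩ ker g)` of a two-step sequence
`M₀ → M₁ → M₂` at the middle spot (when `im f ⊆ ker g` this is `dim ker g / im f`). -/
noncomputable def hDim (K : Type*) [Field K] {M₀ M₁ M₂ : Type*}
    [AddCommGroup M₀] [Module K M₀] [AddCommGroup M₁] [Module K M₁]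
    [AddCommGroup M₂] [Module K M₂]
    (f : M₀ →ₗ[K] M₁) (g : M₁ →ₗ[K] M₂) : ℕ :=
  Module.finrank K
    (↥(LinearMap.ker g) ⧸
      Submodule.comap (LinearMap.ker g).subtype (LinearMap.range f))

/-- The Aomoto Betti number at the middle degree: the dimension of
`ker ĥ / im ĥ` for the maps induced by `h` on cohomology, expressed at the cochain level as
`dim ({z ∈ ker δ₁ : h₁ z ∈ im δ₁} / (h₀(ker δ₀) + im δ₀))`. -/
noncomputable def aomotoDim (K : Type*) [Field K] {M₀ M₁ M₂ : Type*}
    [AddCommGroup M₀] [Module K M₀] [AddCommGroup M₁] [Module K M₁]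
    [AddCommGroup M₂] [Module K M₂]
    (δ₀ : M₀ →ₗ[K] M₁) (δ₁ : M₁ →ₗ[K] M₂)
    (h₀ : M₀ →ₗ[K] M₁) (h₁ : M₁ →ₗ[K] M₂) : ℕ :=
  Module.finrank K
    (↥(LinearMap.ker δ₁ ⊓ Submodule.comap h₁ (LinearMap.range δ₁)) ⧸
      Submodule.comap (LinearMap.ker δ₁ ⊓ Submodule.comap h₁ (LinearMap.range δ₁)).subtype
        (Submodule.map h₀ (LinearMap.ker δ₀) ⊔ LinearMap.range δ₀))

/-- The twisted differential `δ ⊗ id + h ⊗ (a·)` on `M ⊗_K A`. -/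
noncomputable def twD (K : Type*) [CommRing K] {M N A : Type*}
    [AddCommGroup M] [Module K M] [AddCommGroup N] [Module K N]
    [CommRing A] [Algebra K A]
    (δ h : M →ₗ[K] N) (a : A) :
    TensorProduct K M A →ₗ[K] TensorProduct K N A :=
  TensorProduct.map δ (LinearMap.id : A →ₗ[K] A)
    + TensorProduct.map h (LinearMap.mulLeft K a)

theorem finrank_comap_quotient_add_finrank {K M : Type*} [Field K] [AddCommGroup M] [Module K M]
    [FiniteDimensional K M] {S T : Submodule K M} (hTS : T ≤ S) :
    Module.finrank K (↥S ⧸ T.comap S.subtype) + Module.finrank K T = Module.finrank K S := by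
  rw [← Submodule.finrank_quotient_add_finrank (T.comap S.subtype),
    (Submodule.comapSubtypeEquivOfLe hTS).finrank_eq]

theorem finrank_map_add_finrank_inf_ker {K M N : Type*} [Field K] [AddCommGroup M] [Module K M]
    [AddCommGroup N] [Module K N] [FiniteDimensional K M] (f : M →ₗ[K] N) (S : Submodule K M) :
    Module.finrank K (S.map f) + Module.finrank K ↥(S ⊓ LinearMap.ker f) =
      Module.finrank K S := by
  rw [← LinearMap.finrank_range_add_finrank_ker (f.domRestrict S), LinearMap.range_domRestrict,
    LinearMap.ker_domRestrict, ← Submodule.finrank_map_subtype_eq S, Submodule.map_comap_subtype]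

/-- The kernel and the image of the map induced by `h` on `ker δ → N / im δ` have complementary
dimensions. -/
theorem finrank_ker_inf_comap_add_finrank_sup {K M N : Type*} [Field K]
    [AddCommGroup M] [Module K M] [AddCommGroup N] [Module K N]
    [FiniteDimensional K M] [FiniteDimensional K N] (δ h : M →ₗ[K] N) :
    Module.finrank K ↥(LinearMap.ker δ ⊓ (LinearMap.range δ).comap h) +
      Module.finrank K ↥((LinearMap.ker δ).map h ⊔ LinearMap.range δ) = Module.finrank K M := by
  have hsup := Submodule.finrank_sup_add_finrank_inf_eq ((LinearMap.ker δ).map h)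
    (LinearMap.range δ)
  have hker := finrank_map_add_finrank_inf_ker h (LinearMap.ker δ)
  have hinf := finrank_map_add_finrank_inf_ker h (LinearMap.ker δ ⊓ (LinearMap.range δ).comap h)
  have hmap : (LinearMap.ker δ ⊓ (LinearMap.range δ).comap h).map h =
      (LinearMap.ker δ).map h ⊓ LinearMap.range δ := by
    ext y
    simp only [Submodule.mem_map, Submodule.mem_inf, Submodule.mem_comap]
    constructor
    · rintro ⟨x, ⟨hx, hx'⟩, rfl⟩
      exact ⟨⟨x, hx, rfl⟩, hx'⟩
    · rintro ⟨⟨x, hx, rfl⟩, hx'⟩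
      exact ⟨x, ⟨hx, hx'⟩, rfl⟩
  have hker' : LinearMap.ker δ ⊓ (LinearMap.range δ).comap h ⊓ LinearMap.ker h =
      LinearMap.ker δ ⊓ LinearMap.ker h := by
    ext x
    simp only [Submodule.mem_inf, Submodule.mem_comap, LinearMap.mem_ker]
    refine ⟨fun hx => ⟨hx.1.1, hx.2⟩, fun hx => ⟨⟨hx.1, ?_⟩, hx.2⟩⟩
    rw [hx.2]
    exact zero_mem _
  rw [hmap, hker'] at hinf
  have := LinearMap.finrank_range_add_finrank_ker δ
  omega

/-- If the first nonvanishing one of the coefficients `c 0, …, c (N - 1)` of an element of `W`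
lies in `T j` whenever it occurs at position `j`, then `dim W ≤ ∑ dim T j`. -/
theorem finrank_le_sum_of_leading_coeff_mem {K V M : Type*} [Field K] [AddCommGroup V]
    [Module K V] [AddCommGroup M] [Module K M] [FiniteDimensional K V] [FiniteDimensional K M]
    (N : ℕ) (W : Submodule K V) (c : ℕ → V →ₗ[K] M) (T : ℕ → Submodule K M)
    (hT : ∀ j < N, ∀ x ∈ W, (∀ i < j, c i x = 0) → c j x ∈ T j)
    (hc : ∀ x ∈ W, (∀ i < N, c i x = 0) → x = 0) :
    Module.finrank K W ≤ ∑ j ∈ Finset.range N, Module.finrank K (T j) := by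
  induction N generalizing W c T with
  | zero =>
    have : W = ⊥ := (Submodule.eq_bot_iff W).2 fun x hx => hc x hx (by simp)
    simp [this]
  | succ N ih =>
    rw [Finset.sum_range_succ', ← finrank_map_add_finrank_inf_ker (c 0) W, add_comm]
    refine add_le_add (ih _ (fun j => c (j + 1)) (fun j => T (j + 1)) ?_ ?_)
      (Submodule.finrank_mono ?_)
    · rintro j hj x ⟨hx, hx0⟩ hlt
      refine hT (j + 1) (by omega) x hx fun i hi => ?_
      cases i with
      | zero => exact hx0
      | succ i => exact hlt i (by omega)
    · rintro x ⟨hx, hx0⟩ hlt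
      refine hc x hx fun i hi => ?_
      cases i with
      | zero => exact hx0
      | succ i => exact hlt i (by omega)
    · rintro _ ⟨x, hx, rfl⟩
      exact hT 0 (by omega) x hx (by simp)

/-- The coefficient functionals on truncated polynomials. -/
noncomputable def truncCoeff (K : Type*) [Field K] (N k : ℕ) :
    (K[X] ⧸ Ideal.span {(X : K[X]) ^ N}) →ₗ[K] K :=
  if hk : k < N then
    (Submodule.liftQ ((Ideal.span {(X : K[X]) ^ N}).restrictScalars K) (lcoeff K k)
      fun p hp => by
        rw [Submodule.restrictScalars_mem, Ideal.mem_span_singleton, X_pow_dvd_iff] at hp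
        exact hp k hk).comp
      (Submodule.Quotient.restrictScalarsEquiv K (Ideal.span {(X : K[X]) ^ N})).symm.toLinearMap
  else 0

theorem truncCoeff_mk {K : Type*} [Field K] {N k : ℕ} (hk : k < N) (p : K[X]) :
    truncCoeff K N k (Ideal.Quotient.mk _ p) = p.coeff k := by
  rw [truncCoeff, dif_pos hk]
  rfl

theorem truncCoeff_succ_comp_mulLeft_X {K : Type*} [Field K] {N k : ℕ} (hk : k + 1 < N) :
    (truncCoeff K N (k + 1)).comp (LinearMap.mulLeft K (Ideal.Quotient.mk _ X)) =
      truncCoeff K N k := by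
  refine LinearMap.ext fun a => ?_
  obtain ⟨p, rfl⟩ := Ideal.Quotient.mk_surjective a
  rw [LinearMap.comp_apply, LinearMap.mulLeft_apply, ← map_mul, truncCoeff_mk hk,
    truncCoeff_mk (by omega), coeff_X_mul]

theorem truncCoeff_zero_comp_mulLeft_X {K : Type*} [Field K] {N : ℕ} (hN : 0 < N) :
    (truncCoeff K N 0).comp (LinearMap.mulLeft K (Ideal.Quotient.mk _ X)) = 0 := by
  refine LinearMap.ext fun a => ?_
  obtain ⟨p, rfl⟩ := Ideal.Quotient.mk_surjective a
  rw [LinearMap.comp_apply, LinearMap.mulLeft_apply, ← map_mul, truncCoeff_mk hN,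
    coeff_X_mul_zero, LinearMap.zero_apply]

theorem injective_pi_truncCoeff (K : Type*) [Field K] (N : ℕ) :
    Function.Injective (LinearMap.pi fun k : Fin N => truncCoeff K N k) := by
  rw [injective_iff_map_eq_zero]
  intro a ha
  obtain ⟨p, rfl⟩ := Ideal.Quotient.mk_surjective a
  rw [Ideal.Quotient.eq_zero_iff_mem, Ideal.mem_span_singleton, X_pow_dvd_iff]
  intro k hk
  simpa [truncCoeff_mk hk] using congrFun ha ⟨k, hk⟩

/-- The coefficient of `X ^ k` of an element of `M ⊗ K[X] / (X ^ N)`. -/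
noncomputable def tensorCoeff {K : Type*} [Field K] (M : Type*) [AddCommGroup M] [Module K M]
    (N k : ℕ) : TensorProduct K M (K[X] ⧸ Ideal.span {(X : K[X]) ^ N}) →ₗ[K] M :=
  (TensorProduct.rid K M).toLinearMap.comp ((truncCoeff K N k).lTensor M)

section

variable {K M M' : Type*} [Field K] [AddCommGroup M] [Module K M] [AddCommGroup M'] [Module K M']
  {N k : ℕ}

theorem tensorCoeff_tmul (m : M) (a : K[X] ⧸ Ideal.span {(X : K[X]) ^ N}) :
    tensorCoeff M N k (m ⊗ₜ[K] a) = truncCoeff K N k a • m := by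
  simp [tensorCoeff]

theorem eq_zero_of_tensorCoeff_eq_zero
    (x : TensorProduct K M (K[X] ⧸ Ideal.span {(X : K[X]) ^ N}))
    (hx : ∀ k < N, tensorCoeff M N k x = 0) : x = 0 := by
  have hinj := Module.Flat.lTensor_preserves_injective_linearMap (M := M) _
    (injective_pi_truncCoeff K N)
  refine hinj ((TensorProduct.piScalarRight K K M (Fin N)).injective ?_)
  rw [map_zero, map_zero]
  funext k
  have key : (LinearMap.proj k).comp ((TensorProduct.piScalarRight K K M (Fin N)).toLinearMap.comp
      ((LinearMap.pi fun k : Fin N => truncCoeff K N k).lTensor M)) = tensorCoeff M N k := by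
    refine TensorProduct.ext' fun m a => ?_
    simp [tensorCoeff_tmul]
  exact (LinearMap.congr_fun key x).trans (hx k k.2)

theorem tensorCoeff_zero_twD (hN : 0 < N) (δ h : M →ₗ[K] M')
    (x : TensorProduct K M (K[X] ⧸ Ideal.span {(X : K[X]) ^ N})) :
    tensorCoeff M' N 0 (twD K δ h (Ideal.Quotient.mk _ X) x) = δ (tensorCoeff M N 0 x) := by
  induction x with
  | zero => simp
  | add x y hx hy => simp only [map_add, hx, hy]
  | tmul m a =>
    have := LinearMap.congr_fun (truncCoeff_zero_comp_mulLeft_X (K := K) hN) a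
    simp only [LinearMap.comp_apply, LinearMap.zero_apply] at this
    simp [twD, tensorCoeff_tmul, -LinearMap.mulLeft_apply, this]

theorem tensorCoeff_succ_twD (hk : k + 1 < N) (δ h : M →ₗ[K] M')
    (x : TensorProduct K M (K[X] ⧸ Ideal.span {(X : K[X]) ^ N})) :
    tensorCoeff M' N (k + 1) (twD K δ h (Ideal.Quotient.mk _ X) x) =
      δ (tensorCoeff M N (k + 1) x) + h (tensorCoeff M N k x) := by
  induction x with
  | zero => simp
  | add x y hx hy =>
    simp only [map_add, hx, hy]
    abel
  | tmul m a =>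
    have := LinearMap.congr_fun (truncCoeff_succ_comp_mulLeft_X (K := K) hk) a
    simp only [LinearMap.comp_apply] at this
    simp [twD, tensorCoeff_tmul, -LinearMap.mulLeft_apply, this]

instance finite_quotient_span_X_pow :
    Module.Finite K (K[X] ⧸ Ideal.span {(X : K[X]) ^ N}) :=
  (monic_X_pow N).finite_quotient

theorem finrank_ker_twD_le [FiniteDimensional K M] (hN : 1 ≤ N) (δ h : M →ₗ[K] M') :
    Module.finrank K (LinearMap.ker
        (twD K δ h (Ideal.Quotient.mk (Ideal.span {(X : K[X]) ^ N}) X))) ≤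
      Module.finrank K (LinearMap.ker δ) +
        (N - 1) * Module.finrank K ↥(LinearMap.ker δ ⊓ (LinearMap.range δ).comap h) := by
  obtain ⟨N, rfl⟩ : ∃ n, N = n + 1 := ⟨N - 1, by omega⟩
  refine (finrank_le_sum_of_leading_coeff_mem (N + 1) _ (tensorCoeff M (N + 1))
    (fun j => if j < N then LinearMap.ker δ ⊓ (LinearMap.range δ).comap h else LinearMap.ker δ)
    ?_ fun x _ => eq_zero_of_tensorCoeff_eq_zero x).trans (le_of_eq ?_)
  · intro j hj x hx hlt
    have hker : tensorCoeff M (N + 1) j x ∈ LinearMap.ker δ := by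
      rw [LinearMap.mem_ker]
      cases j with
      | zero => rw [← tensorCoeff_zero_twD hj δ h x, LinearMap.mem_ker.1 hx, map_zero]
      | succ j =>
        have := tensorCoeff_succ_twD hj δ h x
        rwa [LinearMap.mem_ker.1 hx, map_zero, hlt j (by omega), map_zero, add_zero,
          eq_comm] at this
    split_ifs with hjN
    · refine ⟨hker, -tensorCoeff M (N + 1) (j + 1) x, ?_⟩
      have := tensorCoeff_succ_twD (k := j) (by omega : j + 1 < N + 1) δ h x
      rw [LinearMap.mem_ker.1 hx, map_zero] at this
      rw [map_neg, neg_eq_iff_add_eq_zero, ← this]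
    · exact hker
  · rw [Finset.sum_range_succ, if_neg (lt_irrefl N), add_comm,
      Finset.sum_congr rfl fun j hj => by rw [if_pos (Finset.mem_range.1 hj)],
      Finset.sum_const, Finset.card_range, smul_eq_mul, Nat.add_sub_cancel]

end

theorem twD_comp_twD {K M₀ M₁ M₂ A : Type*} [CommRing K] [AddCommGroup M₀] [Module K M₀]
    [AddCommGroup M₁] [Module K M₁] [AddCommGroup M₂] [Module K M₂] [CommRing A] [Algebra K A]
    {δ₀ h₀ : M₀ →ₗ[K] M₁} {δ₁ h₁ : M₁ →ₗ[K] M₂} (hδδ : δ₁.comp δ₀ = 0) (hhh : h₁.comp h₀ = 0)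
    (hanti : δ₁.comp h₀ + h₁.comp δ₀ = 0) (a : A) :
    (twD K δ₁ h₁ a).comp (twD K δ₀ h₀ a) = 0 := by
  refine TensorProduct.ext' fun m b => ?_
  have h1 : δ₁ (δ₀ m) = 0 := LinearMap.congr_fun hδδ m
  have h2 : h₁ (h₀ m) = 0 := LinearMap.congr_fun hhh m
  have h3 : δ₁ (h₀ m) + h₁ (δ₀ m) = 0 := LinearMap.congr_fun hanti m
  simp only [twD, LinearMap.comp_apply, LinearMap.add_apply, TensorProduct.map_tmul, map_add,
    LinearMap.id_apply, LinearMap.mulLeft_apply, LinearMap.zero_apply, h1, h2,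
    TensorProduct.zero_tmul, zero_add, add_zero]
  rw [← TensorProduct.add_tmul, add_comm, h3, TensorProduct.zero_tmul]

theorem hDim_add_finrank_range {K M₀ M₁ M₂ : Type*} [Field K]
    [AddCommGroup M₀] [Module K M₀] [AddCommGroup M₁] [Module K M₁]
    [AddCommGroup M₂] [Module K M₂] [FiniteDimensional K M₁]
    {f : M₀ →ₗ[K] M₁} {g : M₁ →ₗ[K] M₂} (hgf : g.comp f = 0) :
    hDim K f g + Module.finrank K (LinearMap.range f) = Module.finrank K (LinearMap.ker g) :=
  finrank_comap_quotient_add_finrank (LinearMap.range_le_ker_iff.2 hgf)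

theorem aomotoDim_add_finrank {K M₀ M₁ M₂ : Type*} [Field K]
    [AddCommGroup M₀] [Module K M₀] [AddCommGroup M₁] [Module K M₁]
    [AddCommGroup M₂] [Module K M₂] [FiniteDimensional K M₁]
    {δ₀ h₀ : M₀ →ₗ[K] M₁} {δ₁ h₁ : M₁ →ₗ[K] M₂} (hδδ : δ₁.comp δ₀ = 0) (hhh : h₁.comp h₀ = 0)
    (hanti : δ₁.comp h₀ + h₁.comp δ₀ = 0) :
    aomotoDim K δ₀ δ₁ h₀ h₁ +
        Module.finrank K ↥((LinearMap.ker δ₀).map h₀ ⊔ LinearMap.range δ₀) =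
      Module.finrank K ↥(LinearMap.ker δ₁ ⊓ (LinearMap.range δ₁).comap h₁) := by
  refine finrank_comap_quotient_add_finrank (sup_le ?_ ?_)
  · rintro _ ⟨x, hx, rfl⟩
    have h2 : h₁ (h₀ x) = 0 := LinearMap.congr_fun hhh x
    have h3 : δ₁ (h₀ x) + h₁ (δ₀ x) = 0 := LinearMap.congr_fun hanti x
    rw [LinearMap.mem_ker.1 hx, map_zero, add_zero] at h3
    exact ⟨h3, 0, by rw [map_zero, h2]⟩
  · rintro _ ⟨x, rfl⟩
    have h3 : δ₁ (h₀ x) + h₁ (δ₀ x) = 0 := LinearMap.congr_fun hanti x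
    exact ⟨LinearMap.congr_fun hδδ x, -h₀ x, by rw [map_neg, neg_eq_iff_add_eq_zero, h3]⟩

/-- For every integer `N ≥ 1` and every degree (written `n+1` with `n : ℤ`
arbitrary), `dim_K H^i(C ⊗ K[X]/(X^N), D) ≤ dim_K H^i(C, δ) + (N−1)·β_i`, where `β_i` is
the `i`-th Aomoto Betti number of `(C, δ, h)`. -/
theorem twisted_cohomology_dim_le
    (K : Type*) [Field K]
    (C : ℤ → Type*) [∀ i, AddCommGroup (C i)] [∀ i, Module K (C i)]
    [∀ i, FiniteDimensional K (C i)]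
    (δ h : ∀ i : ℤ, C i →ₗ[K] C (i + 1))
    (hδδ : ∀ i : ℤ, (δ (i + 1)).comp (δ i) = 0)
    (hhh : ∀ i : ℤ, (h (i + 1)).comp (h i) = 0)
    (hanti : ∀ i : ℤ, (δ (i + 1)).comp (h i) + (h (i + 1)).comp (δ i) = 0)
    (N : ℕ) (hN : 1 ≤ N) (n : ℤ) :
    hDim K
        (twD K (δ n) (h n)
          (Ideal.Quotient.mk (Ideal.span {(X : K[X]) ^ N}) X))
        (twD K (δ (n + 1)) (h (n + 1))
          (Ideal.Quotient.mk (Ideal.span {(X : K[X]) ^ N}) X))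
      ≤ hDim K (δ n) (δ (n + 1))
          + (N - 1) * aomotoDim K (δ n) (δ (n + 1)) (h n) (h (n + 1)) := by
  have hH := hDim_add_finrank_range (hδδ n)
  have hD := hDim_add_finrank_range (twD_comp_twD (hδδ n) (hhh n) (hanti n)
    (Ideal.Quotient.mk (Ideal.span {(X : K[X]) ^ N}) X))
  have hβ := aomotoDim_add_finrank (hδδ n) (hhh n) (hanti n)
  have hcompl := finrank_ker_inf_comap_add_finrank_sup (δ n) (h n)
  have hδ := LinearMap.finrank_range_add_finrank_ker (δ n)
  have htw := LinearMap.finrank_range_add_finrank_ker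
    (twD K (δ n) (h n) (Ideal.Quotient.mk (Ideal.span {(X : K[X]) ^ N}) X))
  have hker₀ := finrank_ker_twD_le hN (δ n) (h n)
  have hker₁ := finrank_ker_twD_le hN (δ (n + 1)) (h (n + 1))
  rw [Module.finrank_tensorProduct, finrank_quotient_span_eq_natDegree, natDegree_X_pow] at htw
  obtain ⟨m, rfl⟩ : ∃ m, N = m + 1 := ⟨N - 1, by omega⟩
  rw [Nat.add_sub_cancel] at *
  rw [← hβ, mul_add] at hker₁
  have hm := congrArg (m * ·) hcompl
  simp only [mul_add] at hm
  rw [mul_add, mul_one, mul_comm] at htw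
  omega
end

section
/- Let k ≥ 1 and i be integers, and suppose α₁, …, α_k ∈ C^i satisfy δα₁ = 0 and δα_{j+1} = h(α_j) for 1 ≤ j ≤ k−1. Then in the twisted complex (C ⊗ K⟦X⟧, D), the element h(α_k) ⊗ 1 ∈ C^{i+1} ⊗ K⟦X⟧ is a cocycle (D(h(α_k) ⊗ 1) = 0), and X^k · (h(α_k) ⊗ 1) is a coboundary; in particular, the cohomology class of h(α_k) ⊗ 1 in H^{i+1}(C ⊗ K⟦X⟧, D) is annihilated by X^k. -/
theorem twD_tmul {K M N A : Type*} [CommRing K]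
    [AddCommGroup M] [Module K M] [AddCommGroup N] [Module K N]
    [CommRing A] [Algebra K A] (δ h : M →ₗ[K] N) (a : A) (m : M) (b : A) :
    twD K δ h a (m ⊗ₜ[K] b) = δ m ⊗ₜ[K] b + h m ⊗ₜ[K] (a * b) := by
  simp [twD]

/-- In a Massey chain, `h (α (m + 1)) ⊗ a ^ (m + 1)` lies in the range of the twisted
differential. -/
theorem tmul_pow_mem_range_twD {K M N A : Type*} [CommRing K]
    [AddCommGroup M] [Module K M] [AddCommGroup N] [Module K N]
    [CommRing A] [Algebra K A] (δ h : M →ₗ[K] N) (a : A) (α : ℕ → M) (m : ℕ)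
    (hα1 : δ (α 1) = 0)
    (hchain : ∀ j : ℕ, 1 ≤ j → j ≤ m → δ (α (j + 1)) = h (α j)) :
    h (α (m + 1)) ⊗ₜ[K] (a ^ (m + 1)) ∈ LinearMap.range (twD K δ h a) := by
  induction m with
  | zero => exact ⟨α 1 ⊗ₜ[K] 1, by simp [twD_tmul, hα1]⟩
  | succ m ih =>
    have hprev := ih fun j h1 hj => hchain j h1 (hj.trans m.le_succ)
    have hD : twD K δ h a (α (m + 1 + 1) ⊗ₜ[K] (a ^ (m + 1))) ∈ LinearMap.range (twD K δ h a) :=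
      LinearMap.mem_range_self _ _
    rw [twD_tmul, hchain (m + 1) m.succ_pos le_rfl, ← pow_succ'] at hD
    exact (Submodule.add_mem_iff_right _ hprev).mp hD

/-- if `α 1, …, α k` is a Massey `k`-chain in degree `i = n+1`
(`δ(α 1) = 0` and `δ(α (j+1)) = h(α j)` for `1 ≤ j ≤ k−1`), then in the twisted complex
`(C ⊗ K⟦X⟧, D)` the element `h(α k) ⊗ 1` is a cocycle and `X^k · (h(α k) ⊗ 1) = h(α k) ⊗ X^k`
is a coboundary; in particular its cohomology class is annihilated by `X^k`. -/
theorem massey_chain_gives_torsion_class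
    (K : Type*) [Field K]
    (C : ℤ → Type*) [∀ i, AddCommGroup (C i)] [∀ i, Module K (C i)]
    (δ h : ∀ i : ℤ, C i →ₗ[K] C (i + 1))
    (hδδ : ∀ i : ℤ, (δ (i + 1)).comp (δ i) = 0)
    (hhh : ∀ i : ℤ, (h (i + 1)).comp (h i) = 0)
    (hanti : ∀ i : ℤ, (δ (i + 1)).comp (h i) + (h (i + 1)).comp (δ i) = 0)
    (n : ℤ) (k : ℕ) (hk : 1 ≤ k) (α : ℕ → C (n + 1))
    (hα1 : δ (n + 1) (α 1) = 0)
    (hchain : ∀ j : ℕ, 1 ≤ j → j ≤ k - 1 → δ (n + 1) (α (j + 1)) = h (n + 1) (α j)) :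
    twD K (δ (n + 1 + 1)) (h (n + 1 + 1)) (PowerSeries.X : PowerSeries K)
        ((h (n + 1) (α k)) ⊗ₜ[K] (1 : PowerSeries K)) = 0 ∧
    (h (n + 1) (α k)) ⊗ₜ[K] ((PowerSeries.X : PowerSeries K) ^ k) ∈
      LinearMap.range (twD K (δ (n + 1)) (h (n + 1)) (PowerSeries.X : PowerSeries K)) := by
  obtain ⟨m, rfl⟩ : ∃ m, k = m + 1 := ⟨k - 1, (Nat.sub_add_cancel hk).symm⟩
  have hhα : ∀ x, h (n + 1 + 1) (h (n + 1) x) = 0 := LinearMap.congr_fun (hhh (n + 1))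
  have hδh : δ (n + 1 + 1) (h (n + 1) (α (m + 1))) = 0 := by
    have hδα : h (n + 1 + 1) (δ (n + 1) (α (m + 1))) = 0 := by
      cases m with
      | zero => rw [hα1, map_zero]
      | succ m => rw [hchain (m + 1) m.succ_pos le_rfl, hhα]
    have hsum := LinearMap.congr_fun (hanti (n + 1)) (α (m + 1))
    simpa [hδα] using hsum
  refine ⟨?_, tmul_pow_mem_range_twD _ _ _ α m hα1 hchain⟩
  rw [twD_tmul, hδh, hhα, TensorProduct.zero_tmul, TensorProduct.zero_tmul, add_zero]
end
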